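/- Let a, b ∈ ℝ³ with aᵢ < bᵢ for each i, let γ, α, β, ε > 0, let f : ℝ³ → ℝ be continuous on Icc a b, and let u₀ : ℝ³ → ℝ be twice continuously differentiable on a neighborhood of Icc a b with u₀ = 0 on the frontier of Icc a b, satisfying −γ·Δu₀ + α·u₀³ − β·u₀ − f = 0 on Icc a b. For φ : ℝ³ → ℝ twice continuously differentiable on a neighborhood of Icc a b with φ = 0 on the frontier of Icc a b, define h(t) = Ĵ_ε(u₀ + t·φ), where Ĵ_ε(u) = −(γ/2)∫‖∇u‖² dx − (3α/4)∫u⁴ dx + ((β+ε)/2)∫u² dx − (1/(2ε))∫(−γ·Δu + α·u³ − (β+ε)·u − f)² dx over Icc a b. Then h is differentiable at t = 0 and h′(0) = 0; that is, u₀ is a critical point of the dual functional: δĴ_ε(u₀) = 0. -/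

import Mathlib

open MeasureTheory

/-- The closed rectangular box `{x : aᵢ ≤ xᵢ ≤ bᵢ}` in `ℝ³`. -/
def closedBox (a b : Fin 3 → ℝ) : Set (EuclideanSpace ℝ (Fin 3)) :=
  {x | ∀ i, x i ∈ Set.Icc (a i) (b i)}

/-- The Laplacian of `u : ℝ³ → ℝ`, as the trace of the derivative of the
gradient of `u`. -/
noncomputable def lap (u : EuclideanSpace ℝ (Fin 3) → ℝ)
    (x : EuclideanSpace ℝ (Fin 3)) : ℝ :=
  LinearMap.trace ℝ (EuclideanSpace ℝ (Fin 3))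
    (fderiv ℝ (gradient u) x : EuclideanSpace ℝ (Fin 3) →ₗ[ℝ]
      EuclideanSpace ℝ (Fin 3))

/-- The primal–dual functional `Ĵ_ε` on the closed box `[a, b] ⊂ ℝ³`. -/
noncomputable def Jhat (γ α β ε : ℝ) (f : EuclideanSpace ℝ (Fin 3) → ℝ)
    (a b : Fin 3 → ℝ) (u : EuclideanSpace ℝ (Fin 3) → ℝ) : ℝ :=
  -(γ / 2) * (∫ x in closedBox a b, ‖gradient u x‖ ^ 2)
    - (3 * α / 4) * (∫ x in closedBox a b, u x ^ 4)
    + ((β + ε) / 2) * (∫ x in closedBox a b, u x ^ 2)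
    - (1 / (2 * ε)) * (∫ x in closedBox a b,
        (-γ * lap u x + α * u x ^ 3 - (β + ε) * u x - f x) ^ 2)

theorem closedBox_eq_preimage (a b : Fin 3 → ℝ) :
    closedBox a b = EuclideanSpace.equiv (Fin 3) ℝ ⁻¹' Set.Icc a b := by
  ext x
  simp [closedBox, Pi.le_def, forall_and]

theorem isCompact_closedBox (a b : Fin 3 → ℝ) : IsCompact (closedBox a b) := by
  rw [closedBox_eq_preimage]
  exact (EuclideanSpace.equiv (Fin 3) ℝ).toHomeomorph.isCompact_preimage.2 isCompact_Icc

/-- A point of the box with a coordinate at an end of its interval lies on the frontier. -/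
theorem mem_frontier_closedBox {a b : Fin 3 → ℝ} {x : EuclideanSpace ℝ (Fin 3)}
    (hx : x ∈ closedBox a b) {i : Fin 3} (hi : x i = a i ∨ x i = b i) :
    x ∈ frontier (closedBox a b) := by
  rw [(isCompact_closedBox a b).isClosed.frontier_eq]
  refine ⟨hx, fun hint => ?_⟩
  have hpre : closedBox a b ⊆
      EuclideanSpace.equiv (Fin 3) ℝ ⁻¹' ((fun y => y i) ⁻¹' Set.Icc (a i) (b i)) :=
    fun y hy => hy i
  have h := interior_mono hpre hint
  erw [← (EuclideanSpace.equiv (Fin 3) ℝ).toHomeomorph.preimage_interior,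
    ← (isOpenMap_eval i).preimage_interior_eq_interior_preimage (continuous_apply i),
    interior_Icc] at h
  have h1 : a i < x i := h.1
  have h2 : x i < b i := h.2
  rcases hi with hi | hi <;> linarith

/-- The divergence theorem on a box, for a field vanishing on the frontier. -/
theorem integral_divergence_eq_zero {a b : Fin 3 → ℝ} (hab : a ≤ b)
    {W : Set (EuclideanSpace ℝ (Fin 3))} (hW : IsOpen W) (hBW : closedBox a b ⊆ W)
    {v : Fin 3 → EuclideanSpace ℝ (Fin 3) → ℝ} (hv : ∀ i, ContDiffOn ℝ 1 (v i) W)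
    (hbd : ∀ i, ∀ x ∈ frontier (closedBox a b), v i x = 0) :
    ∫ x in closedBox a b, ∑ i, fderiv ℝ (v i) x (EuclideanSpace.single i 1) = 0 := by
  set e := (EuclideanSpace.equiv (Fin 3) ℝ).symm with he
  have hmp : MeasurePreserving e volume volume := PiLp.volume_preserving_toLp (Fin 3)
  have hpre : e ⁻¹' closedBox a b = Set.Icc a b := by
    ext y; simp [closedBox_eq_preimage, he]
  have hmem : ∀ y ∈ Set.Icc a b, e y ∈ closedBox a b := hpre.ge
  have hcont : ContinuousOn
      (fun x => ∑ i, fderiv ℝ (v i) x (EuclideanSpace.single i 1)) W :=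
    continuousOn_finsetSum _ fun i _ =>
      ((hv i).continuousOn_fderiv_of_isOpen hW le_rfl).clm_apply continuousOn_const
  rw [← hmp.setIntegral_preimage_emb e.toHomeomorph.measurableEmbedding, hpre]
  have hmaps : Set.MapsTo e (Set.Icc a b) W := fun y hy => hBW (hmem y hy)
  have key := integral_divergence_of_hasFDerivAt_off_countable' a b hab
    (fun i y => v i (e y))
    (fun i y => (fderiv ℝ (v i) (e y)).comp
      (e : (Fin 3 → ℝ) →L[ℝ] EuclideanSpace ℝ (Fin 3))) ∅ Set.countable_empty
    (fun i => (hv i).continuousOn.comp e.continuous.continuousOn hmaps)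
    (fun y hy i => by
      have hyW : e y ∈ W := hmaps ⟨fun j => (hy.1 j trivial).1.le, fun j => (hy.1 j trivial).2.le⟩
      exact (((hv i).contDiffAt (hW.mem_nhds hyW)).differentiableAt
        one_ne_zero).hasFDerivAt.comp y e.hasFDerivAt)
    ((hcont.comp e.continuous.continuousOn hmaps).integrableOn_compact isCompact_Icc)
  refine key.trans (Finset.sum_eq_zero fun i _ => ?_)
  have hface : ∀ c, (c = a i ∨ c = b i) →
      ∫ y in Set.Icc (a ∘ i.succAbove) (b ∘ i.succAbove), v i (e (i.insertNth c y)) = 0 := by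
    intro c hc
    refine setIntegral_eq_zero_of_forall_eq_zero fun y hy => hbd i _ ?_
    have hcI : c ∈ Set.Icc (a i) (b i) := by
      rcases hc with rfl | rfl <;> simp [hab i]
    refine mem_frontier_closedBox (i := i) (hmem _ ?_) (by simpa [he] using hc)
    rw [Fin.insertNth_mem_Icc]
    exact ⟨hcI, hy⟩
  rw [hface _ (Or.inr rfl), hface _ (Or.inl rfl), sub_zero]

/-- An integral depending polynomially on a parameter is differentiable at `0`, and its derivative
is the integral of the linear coefficient. -/
theorem hasDerivAt_setIntegral_polynomial {K : Set (EuclideanSpace ℝ (Fin 3))} (hK : IsCompact K)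
    {n : ℕ} (c : Fin (n + 2) → EuclideanSpace ℝ (Fin 3) → ℝ)
    (hc : ∀ k, ContinuousOn (c k) K) {G : ℝ → EuclideanSpace ℝ (Fin 3) → ℝ}
    (hG : ∀ t, ∀ x ∈ K, G t x = ∑ k : Fin (n + 2), t ^ (k : ℕ) * c k x) :
    HasDerivAt (fun t => ∫ x in K, G t x) (∫ x in K, c 1 x) 0 := by
  have hsum : (fun t => ∫ x in K, G t x) = fun t => ∑ k : Fin (n + 2), t ^ (k : ℕ) * ∫ x in K, c k x := by
    ext t
    rw [setIntegral_congr_fun hK.measurableSet (hG t), integral_finsetSum]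
    · simp_rw [integral_const_mul]
    · exact fun k _ => ((hc k).integrableOn_compact hK).const_mul _
  rw [hsum]
  have hd : HasDerivAt (fun t : ℝ => ∑ k : Fin (n + 2), t ^ (k : ℕ) * ∫ x in K, c k x)
      (∑ k : Fin (n + 2), ((k : ℕ) : ℝ) * 0 ^ ((k : ℕ) - 1) * ∫ x in K, c k x) 0 :=
    HasDerivAt.fun_sum fun k _ => (hasDerivAt_pow _ _).mul_const _
  convert hd using 1
  rw [Fin.sum_univ_succ, Fin.sum_univ_succ]
  simp

theorem lap_eq_sum (u : EuclideanSpace ℝ (Fin 3) → ℝ) (x : EuclideanSpace ℝ (Fin 3)) :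
    lap u x = ∑ i, fderiv ℝ (gradient u) x (EuclideanSpace.single i 1) i := by
  rw [lap, LinearMap.trace_eq_sum_inner _ (EuclideanSpace.basisFun (Fin 3) ℝ)]
  simp [EuclideanSpace.inner_single_left]

theorem contDiffOn_gradient {u : EuclideanSpace ℝ (Fin 3) → ℝ}
    {W : Set (EuclideanSpace ℝ (Fin 3))} (hW : IsOpen W) (hu : ContDiffOn ℝ 2 u W) :
    ContDiffOn ℝ 1 (gradient u) W :=
  (InnerProductSpace.toDual ℝ (EuclideanSpace ℝ (Fin 3))).symm.contDiff.comp_contDiffOn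
    (hu.fderiv_of_isOpen hW (by norm_num))

theorem continuousOn_lap {u : EuclideanSpace ℝ (Fin 3) → ℝ}
    {W : Set (EuclideanSpace ℝ (Fin 3))} (hW : IsOpen W) (hu : ContDiffOn ℝ 2 u W) :
    ContinuousOn (lap u) W := by
  have h := (contDiffOn_gradient hW hu).continuousOn_fderiv_of_isOpen hW le_rfl
  rw [show lap u = _ from funext (lap_eq_sum u)]
  exact continuousOn_finsetSum _ fun i _ =>
    (EuclideanSpace.proj i).continuous.comp_continuousOn (h.clm_apply continuousOn_const)

theorem gradient_add_mul {u φ : EuclideanSpace ℝ (Fin 3) → ℝ} {x : EuclideanSpace ℝ (Fin 3)}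
    (hu : DifferentiableAt ℝ u x) (hφ : DifferentiableAt ℝ φ x) (t : ℝ) :
    gradient (fun y => u y + t * φ y) x = gradient u x + t • gradient φ x := by
  simp only [gradient]
  rw [fderiv_fun_add hu (hφ.const_mul t), fderiv_const_mul hφ, map_add, map_smulₛₗ]
  simp

theorem lap_add_mul {u φ : EuclideanSpace ℝ (Fin 3) → ℝ}
    {W : Set (EuclideanSpace ℝ (Fin 3))} (hW : IsOpen W) (hu : ContDiffOn ℝ 2 u W)
    (hφ : ContDiffOn ℝ 2 φ W) {x : EuclideanSpace ℝ (Fin 3)} (hx : x ∈ W) (t : ℝ) :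
    lap (fun y => u y + t * φ y) x = lap u x + t * lap φ x := by
  have hd : ∀ {w : EuclideanSpace ℝ (Fin 3) → ℝ}, ContDiffOn ℝ 2 w W → ∀ y ∈ W,
      DifferentiableAt ℝ w y := fun hw y hy =>
    (hw.contDiffAt (hW.mem_nhds hy)).differentiableAt two_ne_zero
  have hg : ∀ {w : EuclideanSpace ℝ (Fin 3) → ℝ}, ContDiffOn ℝ 2 w W →
      DifferentiableAt ℝ (gradient w) x := fun hw =>
    ((contDiffOn_gradient hW hw).contDiffAt (hW.mem_nhds hx)).differentiableAt one_ne_zero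
  have heq : gradient (fun y => u y + t * φ y) =ᶠ[nhds x] fun y => gradient u y + t • gradient φ y :=
    Filter.eventually_of_mem (hW.mem_nhds hx) fun y hy =>
      gradient_add_mul (hd hu y hy) (hd hφ y hy) t
  simp only [lap_eq_sum]
  rw [heq.fderiv_eq, fderiv_fun_add (hg hu) ((hg hφ).fun_const_smul t), fderiv_fun_const_smul (hg hφ)]
  simp [Finset.sum_add_distrib, Finset.mul_sum]

/-- Green's first identity on a box, when `u` vanishes on the frontier. -/
theorem integral_inner_gradient_add_mul_lap {a b : Fin 3 → ℝ} (hab : a ≤ b)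
    {W : Set (EuclideanSpace ℝ (Fin 3))} (hW : IsOpen W) (hBW : closedBox a b ⊆ W)
    {u φ : EuclideanSpace ℝ (Fin 3) → ℝ} (hu : ContDiffOn ℝ 2 u W) (hφ : ContDiffOn ℝ 2 φ W)
    (hbd : ∀ x ∈ frontier (closedBox a b), u x = 0) :
    ∫ x in closedBox a b, (inner ℝ (gradient u x) (gradient φ x) + u x * lap φ x) = 0 := by
  have hgi : ∀ i : Fin 3, ContDiffOn ℝ 1 (fun x => gradient φ x i) W := fun i =>
    (EuclideanSpace.proj (𝕜 := ℝ) i).contDiff.comp_contDiffOn (contDiffOn_gradient hW hφ)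
  have hdiv := integral_divergence_eq_zero (v := fun i x => u x * gradient φ x i) hab hW hBW
    (fun i => (hu.of_le one_le_two).mul (hgi i)) (fun i x hx => by simp [hbd x hx])
  rw [← hdiv]
  refine setIntegral_congr_fun (isCompact_closedBox a b).measurableSet fun x hx => ?_
  have hxW := hW.mem_nhds (hBW hx)
  have hux := (hu.contDiffAt hxW).differentiableAt two_ne_zero
  have hgx := ((contDiffOn_gradient hW hφ).contDiffAt hxW).differentiableAt one_ne_zero
  have hcoord : ∀ i : Fin 3, fderiv ℝ (fun y => gradient φ y i) x (EuclideanSpace.single i 1) =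
      fderiv ℝ (gradient φ) x (EuclideanSpace.single i 1) i := fun i => by
    have h := ((EuclideanSpace.proj (𝕜 := ℝ) i).hasFDerivAt.comp x hgx.hasFDerivAt).fderiv
    exact DFunLike.congr_fun h _
  have hgrad : ∀ i : Fin 3, fderiv ℝ u x (EuclideanSpace.single i 1) = gradient u x i := fun i => by
    rw [← inner_gradient_left]
    simp [EuclideanSpace.inner_single_right, -inner_gradient_left]
  simp only [lap_eq_sum, PiLp.inner_apply, Finset.mul_sum, ← Finset.sum_add_distrib]
  refine Finset.sum_congr rfl fun i _ => ?_
  rw [fderiv_fun_mul hux (((hgi i).contDiffAt hxW).differentiableAt one_ne_zero)]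
  simp [hcoord, hgrad]
  ring

/-- A critical point `u₀` of the primal functional `J` (a solution of the
Euler–Lagrange equation with zero Dirichlet data on a rectangular box) is also
a critical point of the dual functional `Ĵ_ε`: for every admissible direction
`φ`, the map `t ↦ Ĵ_ε(u₀ + tφ)` is differentiable at `t = 0` with derivative
`0`, i.e. `δĴ_ε(u₀) = 0`. -/
theorem dual_critical_point (a b : Fin 3 → ℝ) (hab : ∀ i, a i < b i)
    (γ α β ε : ℝ) (hγ : 0 < γ) (hα : 0 < α) (hβ : 0 < β) (hε : 0 < ε)
    (f u₀ : EuclideanSpace ℝ (Fin 3) → ℝ)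
    (hf : ContinuousOn f (closedBox a b))
    (U : Set (EuclideanSpace ℝ (Fin 3))) (hU : IsOpen U)
    (hBU : closedBox a b ⊆ U) (hu₀ : ContDiffOn ℝ 2 u₀ U)
    (hbd : ∀ x ∈ frontier (closedBox a b), u₀ x = 0)
    (hEL : ∀ x ∈ closedBox a b,
      -γ * lap u₀ x + α * u₀ x ^ 3 - β * u₀ x - f x = 0)
    (φ : EuclideanSpace ℝ (Fin 3) → ℝ)
    (Uφ : Set (EuclideanSpace ℝ (Fin 3))) (hUφ : IsOpen Uφ)
    (hBUφ : closedBox a b ⊆ Uφ) (hφ : ContDiffOn ℝ 2 φ Uφ)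
    (hbdφ : ∀ x ∈ frontier (closedBox a b), φ x = 0) :
    HasDerivAt
      (fun t : ℝ => Jhat γ α β ε f a b (fun x => u₀ x + t * φ x)) 0 0 := by
  have hW : IsOpen (U ∩ Uφ) := hU.inter hUφ
  have hBW : closedBox a b ⊆ U ∩ Uφ := Set.subset_inter hBU hBUφ
  replace hu₀ := hu₀.mono (Set.inter_subset_left (t := Uφ))
  replace hφ := hφ.mono (Set.inter_subset_right (s := U))
  have hK := isCompact_closedBox a b
  have hdiff : ∀ {w : EuclideanSpace ℝ (Fin 3) → ℝ}, ContDiffOn ℝ 2 w (U ∩ Uφ) →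
      ∀ x ∈ closedBox a b, DifferentiableAt ℝ w x := fun hw x hx =>
    (hw.contDiffAt (hW.mem_nhds (hBW hx))).differentiableAt two_ne_zero
  have cu := hu₀.continuousOn.mono hBW
  have cφ := hφ.continuousOn.mono hBW
  have cgu := (contDiffOn_gradient hW hu₀).continuousOn.mono hBW
  have cgφ := (contDiffOn_gradient hW hφ).continuousOn.mono hBW
  have clφ := (continuousOn_lap hW hφ).mono hBW
  have cinner : ContinuousOn (fun x => inner ℝ (gradient u₀ x) (gradient φ x)) (closedBox a b) :=
    cgu.inner cgφ
  have h₁ := hasDerivAt_setIntegral_polynomial hK (n := 1)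
    (G := fun t x => ‖gradient (fun y => u₀ y + t * φ y) x‖ ^ 2)
    ![fun x => ‖gradient u₀ x‖ ^ 2, fun x => 2 * inner ℝ (gradient u₀ x) (gradient φ x),
      fun x => ‖gradient φ x‖ ^ 2]
    (by intro k; fin_cases k <;> simp [-inner_gradient_left, -inner_gradient_right] <;> fun_prop)
    (by
      intro t x hx
      simp only [gradient_add_mul (hdiff hu₀ x hx) (hdiff hφ x hx), norm_add_sq_real]
      simp [Fin.sum_univ_succ, inner_smul_right, norm_smul, mul_pow]
      ring)
  have h₂ := hasDerivAt_setIntegral_polynomial hK (n := 3)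
    (G := fun t x => (u₀ x + t * φ x) ^ 4)
    ![fun x => u₀ x ^ 4, fun x => 4 * (u₀ x ^ 3 * φ x), fun x => 6 * u₀ x ^ 2 * φ x ^ 2,
      fun x => 4 * u₀ x * φ x ^ 3, fun x => φ x ^ 4]
    (by intro k; fin_cases k <;> simp <;> fun_prop)
    (by
      intro t x hx
      simp [Fin.sum_univ_succ]
      ring)
  have h₃ := hasDerivAt_setIntegral_polynomial hK (n := 1)
    (G := fun t x => (u₀ x + t * φ x) ^ 2)
    ![fun x => u₀ x ^ 2, fun x => 2 * (u₀ x * φ x), fun x => φ x ^ 2]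
    (by intro k; fin_cases k <;> simp <;> fun_prop)
    (by
      intro t x hx
      simp [Fin.sum_univ_succ]
      ring)
  obtain ⟨L, hL⟩ : ∃ L : EuclideanSpace ℝ (Fin 3) → ℝ, ∀ x,
      L x = -γ * lap φ x + 3 * α * u₀ x ^ 2 * φ x - (β + ε) * φ x := ⟨_, fun _ => rfl⟩
  have cL : ContinuousOn L (closedBox a b) := by
    rw [funext hL]
    fun_prop
  have h₄ := hasDerivAt_setIntegral_polynomial hK (n := 5)
    (G := fun t x => (-γ * lap (fun y => u₀ y + t * φ y) x + α * (u₀ x + t * φ x) ^ 3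
      - (β + ε) * (u₀ x + t * φ x) - f x) ^ 2)
    ![fun x => ε ^ 2 * u₀ x ^ 2, fun x => -(2 * ε) * (u₀ x * L x),
      fun x => L x ^ 2 - 6 * ε * α * u₀ x ^ 2 * φ x ^ 2,
      fun x => 6 * α * L x * u₀ x * φ x ^ 2 - 2 * ε * α * u₀ x * φ x ^ 3,
      fun x => 9 * α ^ 2 * u₀ x ^ 2 * φ x ^ 4 + 2 * α * L x * φ x ^ 3,
      fun x => 6 * α ^ 2 * u₀ x * φ x ^ 5, fun x => α ^ 2 * φ x ^ 6]
    (by intro k; fin_cases k <;> simp <;> fun_prop)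
    (by
      intro t x hx
      have hres : -γ * lap (fun y => u₀ y + t * φ y) x + α * (u₀ x + t * φ x) ^ 3
          - (β + ε) * (u₀ x + t * φ x) - f x =
          -ε * u₀ x + t * L x + t ^ 2 * (3 * α * u₀ x * φ x ^ 2) + t ^ 3 * (α * φ x ^ 3) := by
        rw [lap_add_mul hW hu₀ hφ (hBW hx), hL]
        linear_combination hEL x hx
      simp only [hres]
      simp [Fin.sum_univ_succ]
      ring)
  have hJ := (((h₁.const_mul (-(γ / 2))).sub (h₂.const_mul (3 * α / 4))).add
    (h₃.const_mul ((β + ε) / 2))).sub (h₄.const_mul (1 / (2 * ε)))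
  refine hJ.congr_deriv ?_
  have huL : ∫ x in closedBox a b, u₀ x * L x =
      -γ * (∫ x in closedBox a b, u₀ x * lap φ x) + 3 * α * (∫ x in closedBox a b, u₀ x ^ 3 * φ x)
        - (β + ε) * ∫ x in closedBox a b, u₀ x * φ x := by
    simp only [← integral_const_mul]
    rw [← integral_add, ← integral_sub]
    · congr 1 with x
      simp only [hL]
      ring
    all_goals exact ContinuousOn.integrableOn_compact hK (by fun_prop)
  have hgreen := integral_inner_gradient_add_mul_lap (fun i => (hab i).le) hW hBW hu₀ hφ hbd
  rw [integral_add (cinner.integrableOn_compact hK)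
    (ContinuousOn.integrableOn_compact hK (cu.fun_mul clφ))] at hgreen
  simp only [Matrix.cons_val_one, Matrix.cons_val_zero, integral_const_mul, huL]
  field_simp
  linear_combination -γ * hgreen
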